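/- Assume |𝒳| ≥ 2 and |𝒴| ≥ 2, let α = min{log|𝒳|, log|𝒴|}, d_max = max_{x,y} d(x,y), and suppose the rate distortion function Δ′ ↦ R(Δ′|P) is differentiable at Δ with derivative R′(Δ|P). Then: (i) λ ↦ R_cut^{(λ)}(Δ|P) is monotone nonincreasing in λ ∈ (0,1]; (ii) if 0 < λ ≤ 1/(8α), then 0 ≤ R(Δ|P) − R_cut^{(λ)}(Δ|P) ≤ c₁·√λ·( log(1/λ) + c₂ ), where c₁ = (3/2)·√(2α) and c₂ = (4/3)·log(|𝒳||𝒴|) − log(2α) + (2/3)·d_max·|R′(Δ|P)|; consequently R_cut^{(λ)}(Δ|P) → R(Δ|P) as λ → 0⁺. -/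

import Mathlib

open Real Filter

noncomputable section

def IsDist {X : Type*} [Fintype X] (P : X → ℝ) : Prop :=
  (∀ x, 0 ≤ P x) ∧ ∑ x, P x = 1

def IsJoint {X Y : Type*} [Fintype X] [Fintype Y] (q : X → Y → ℝ) : Prop :=
  (∀ x y, 0 ≤ q x y) ∧ ∑ x, ∑ y, q x y = 1

def IsCond {X Y : Type*} [Fintype X] [Fintype Y] (V : X → Y → ℝ) : Prop :=
  (∀ x y, 0 ≤ V x y) ∧ ∀ x, ∑ y, V x y = 1

def margX {X Y : Type*} [Fintype Y] (q : X → Y → ℝ) (x : X) : ℝ := ∑ y, q x y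

def margY {X Y : Type*} [Fintype X] (q : X → Y → ℝ) (y : Y) : ℝ := ∑ x, q x y

/-- conditional distribution of `X` given `Y` : `q_{X|Y}(x|y)` -/
def condXY {X Y : Type*} [Fintype X] (q : X → Y → ℝ) (x : X) (y : Y) : ℝ :=
  q x y / margY q y

/-- conditional distribution of `Y` given `X` : `q_{Y|X}(y|x)` -/
def condYX {X Y : Type*} [Fintype Y] (q : X → Y → ℝ) (x : X) (y : Y) : ℝ :=
  q x y / margX q x

/-- mutual information `I(q_X, q_{Y|X})` of a joint distribution `q` -/
def mutInfo {X Y : Type*} [Fintype X] [Fintype Y] (q : X → Y → ℝ) : ℝ :=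
  ∑ x, ∑ y, q x y * Real.log (q x y / (margX q x * margY q y))

/-- divergence `D(q_X ‖ P)` -/
def klX {X Y : Type*} [Fintype X] [Fintype Y] (q : X → Y → ℝ) (P : X → ℝ) : ℝ :=
  ∑ x, margX q x * Real.log (margX q x / P x)

/-- divergence `D(p ‖ q)` of distributions on `X` -/
def klD {X : Type*} [Fintype X] (p q : X → ℝ) : ℝ :=
  ∑ x, p x * Real.log (p x / q x)

/-- divergence `D(q ‖ p)` of joint distributions -/
def klJoint {X Y : Type*} [Fintype X] [Fintype Y] (q p : X → Y → ℝ) : ℝ :=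
  ∑ x, ∑ y, q x y * Real.log (q x y / p x y)

/-- expected distortion `E_q[d(X,Y)]` -/
def Ed {X Y : Type*} [Fintype X] [Fintype Y] (q d : X → Y → ℝ) : ℝ :=
  ∑ x, ∑ y, q x y * d x y

/-- `G(R,Δ|P)` -/
def G {X Y : Type*} [Fintype X] [Fintype Y] (P : X → ℝ) (d : X → Y → ℝ) (R Δ : ℝ) : ℝ :=
  sInf {v : ℝ | ∃ q : X → Y → ℝ, IsJoint q ∧ Ed q d ≤ Δ ∧
    v = max 0 (mutInfo q - R) + klX q P}

/-- `G^{(λ)}(R,Δ|P)` -/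
def Glam {X Y : Type*} [Fintype X] [Fintype Y] (P : X → ℝ) (d : X → Y → ℝ)
    (lam R Δ : ℝ) : ℝ :=
  sInf {v : ℝ | ∃ q : X → Y → ℝ, IsJoint q ∧ Ed q d ≤ Δ ∧
    v = lam * (mutInfo q - R) + klX q P}

/-- rate distortion function `R(Δ|P)` -/
def RD {X Y : Type*} [Fintype X] [Fintype Y] (P : X → ℝ) (d : X → Y → ℝ) (Δ : ℝ) : ℝ :=
  sInf {v : ℝ | ∃ V : X → Y → ℝ, IsCond V ∧ Ed (fun x y => P x * V x y) d ≤ Δ ∧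
    v = mutInfo (fun x y => P x * V x y)}

/-- `Ω^{(μ,λ)}(P)` -/
def OmegaF {X Y : Type*} [Fintype X] [Fintype Y] (P : X → ℝ) (d : X → Y → ℝ)
    (μ lam : ℝ) : ℝ :=
  sInf {v : ℝ | ∃ q : X → Y → ℝ, IsJoint q ∧
    v = lam * mutInfo q + klX q P + μ * Ed q d}

/-- `G^{(μ,λ)}(R,Δ|P) = Ω^{(μ,λ)}(P) − λR − μΔ` -/
def Gmulam {X Y : Type*} [Fintype X] [Fintype Y] (P : X → ℝ) (d : X → Y → ℝ)
    (μ lam R Δ : ℝ) : ℝ :=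
  OmegaF P d μ lam - lam * R - μ * Δ

/-- `ω_q^{(μ,λ)}(x,y)` -/
def omg {X Y : Type*} [Fintype X] [Fintype Y] (P : X → ℝ) (d : X → Y → ℝ)
    (μ lam : ℝ) (q : X → Y → ℝ) (x : X) (y : Y) : ℝ :=
  Real.log (margX q x ^ (1 - lam) * condXY q x y ^ lam * Real.exp (μ * d x y) / P x)

/-- `F^{(μ,λ)}(p,q) = E_q[ω_p^{(μ,λ)}(X,Y)] + D(q‖p)` -/
def Ffun {X Y : Type*} [Fintype X] [Fintype Y] (P : X → ℝ) (d : X → Y → ℝ)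
    (μ lam : ℝ) (p q : X → Y → ℝ) : ℝ :=
  (∑ x, ∑ y, q x y * omg P d μ lam p x y) + klJoint q p

/-- `Λ_p^{(μ,λ)} = E_p[exp(−ω_p^{(μ,λ)}(X,Y))]` -/
def Lam {X Y : Type*} [Fintype X] [Fintype Y] (P : X → ℝ) (d : X → Y → ℝ)
    (μ lam : ℝ) (p : X → Y → ℝ) : ℝ :=
  ∑ x, ∑ y, p x y * Real.exp (-(omg P d μ lam p x y))

/-- cutoff rate `R_cut^{(λ)}(Δ|P)` -/
def Rcut {X Y : Type*} [Fintype X] [Fintype Y] (P : X → ℝ) (d : X → Y → ℝ)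
    (lam Δ : ℝ) : ℝ :=
  sInf {v : ℝ | ∃ q : X → Y → ℝ, IsJoint q ∧ Ed q d ≤ Δ ∧
    v = mutInfo q + (1 / lam) * klX q P}

/-- Shannon entropy -/
def entropy {X : Type*} [Fintype X] (p : X → ℝ) : ℝ :=
  -∑ x, p x * Real.log (p x)

/-- Tangent-line lower bound for `a * log (a / b)`. -/
theorem mul_log_div_ge {a b c : ℝ} (ha : 0 ≤ a) (hb : 0 ≤ b) (hab : b = 0 → a = 0)
    (hc : 0 < c) : a * log c + a - b * c ≤ a * log (a / b) := by
  rcases ha.eq_or_lt with rfl | ha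
  · simp; positivity
  have hb : 0 < b := hb.lt_of_ne fun h => ha.ne' (hab h.symm)
  have h := log_le_sub_one_of_pos (show 0 < b * c / a by positivity)
  rw [log_div (by positivity) ha.ne', log_mul hb.ne' hc.ne'] at h
  rw [log_div ha.ne' hb.ne']
  have h2 := mul_le_mul_of_nonneg_left h ha.le
  have h3 : a * (b * c / a - 1) = b * c - a := by field_simp
  linarith

theorem mul_log_div_ge_sub {a b : ℝ} (ha : 0 ≤ a) (hb : 0 ≤ b) (hab : b = 0 → a = 0) :
    a - b ≤ a * log (a / b) := by
  simpa using mul_log_div_ge ha hb hab one_pos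

/-- Joint convexity of `(a, b) ↦ a * log (a / b)`. -/
theorem mul_log_div_convex {a₁ b₁ a₂ b₂ s t : ℝ} (ha₁ : 0 ≤ a₁) (hb₁ : 0 ≤ b₁)
    (hab₁ : b₁ = 0 → a₁ = 0) (ha₂ : 0 ≤ a₂) (hb₂ : 0 ≤ b₂) (hab₂ : b₂ = 0 → a₂ = 0)
    (hs : 0 ≤ s) (ht : 0 ≤ t) :
    (s * a₁ + t * a₂) * log ((s * a₁ + t * a₂) / (s * b₁ + t * b₂)) ≤
      s * (a₁ * log (a₁ / b₁)) + t * (a₂ * log (a₂ / b₂)) := by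
  set a := s * a₁ + t * a₂ with ha
  set b := s * b₁ + t * b₂ with hb
  have ha0 : 0 ≤ a := by positivity
  rcases ha0.eq_or_lt with h0 | h0
  · have h1 : s * a₁ = 0 := by nlinarith [mul_nonneg hs ha₁, mul_nonneg ht ha₂]
    have h2 : t * a₂ = 0 := by nlinarith [mul_nonneg hs ha₁, mul_nonneg ht ha₂]
    rw [← h0, ← mul_assoc, ← mul_assoc, h1, h2]; simp
  have hb0 : 0 < b := by
    refine lt_of_le_of_ne (by positivity) fun hb0 => h0.ne' ?_
    have h1 : s * b₁ = 0 := by nlinarith [mul_nonneg hs hb₁, mul_nonneg ht hb₂]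
    have h2 : t * b₂ = 0 := by nlinarith [mul_nonneg hs hb₁, mul_nonneg ht hb₂]
    have h3 : s * a₁ = 0 := by
      rcases mul_eq_zero.1 h1 with h | h <;> simp [h, hab₁]
    have h4 : t * a₂ = 0 := by
      rcases mul_eq_zero.1 h2 with h | h <;> simp [h, hab₂]
    rw [ha, h3, h4, add_zero]
  have hc : 0 < a / b := by positivity
  have e1 := mul_le_mul_of_nonneg_left (mul_log_div_ge ha₁ hb₁ hab₁ hc) hs
  have e2 := mul_le_mul_of_nonneg_left (mul_log_div_ge ha₂ hb₂ hab₂ hc) ht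
  have e3 : b * (a / b) = a := by field_simp
  have e4 : s * (a₁ * log (a / b) + a₁ - b₁ * (a / b)) +
      t * (a₂ * log (a / b) + a₂ - b₂ * (a / b)) = a * log (a / b) + a - b * (a / b) := by
    rw [ha, hb]; ring
  linarith

theorem margX_nonneg {X Y : Type*} [Fintype Y] {q : X → Y → ℝ} (hq : ∀ x y, 0 ≤ q x y) (x : X) : 0 ≤ margX q x :=
  Finset.sum_nonneg fun y _ => hq x y

theorem margY_nonneg {X Y : Type*} [Fintype X] {q : X → Y → ℝ} (hq : ∀ x y, 0 ≤ q x y) (y : Y) : 0 ≤ margY q y :=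
  Finset.sum_nonneg fun x _ => hq x y

theorem le_margX {X Y : Type*} [Fintype Y] {q : X → Y → ℝ} (hq : ∀ x y, 0 ≤ q x y) (x : X) (y : Y) :
    q x y ≤ margX q x :=
  Finset.single_le_sum (f := fun y => q x y) (fun y _ => hq x y) (Finset.mem_univ y)

theorem le_margY {X Y : Type*} [Fintype X] {q : X → Y → ℝ} (hq : ∀ x y, 0 ≤ q x y) (x : X) (y : Y) :
    q x y ≤ margY q y :=
  Finset.single_le_sum (f := fun x => q x y) (fun x _ => hq x y) (Finset.mem_univ x)

theorem eq_zero_of_margX {X Y : Type*} [Fintype Y] {q : X → Y → ℝ} (hq : ∀ x y, 0 ≤ q x y) {x : X} (y : Y)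
    (h : margX q x = 0) : q x y = 0 :=
  le_antisymm (h ▸ le_margX hq x y) (hq x y)

theorem eq_zero_of_margY {X Y : Type*} [Fintype X] {q : X → Y → ℝ} (hq : ∀ x y, 0 ≤ q x y) (x : X) {y : Y}
    (h : margY q y = 0) : q x y = 0 :=
  le_antisymm (h ▸ le_margY hq x y) (hq x y)

section

variable {X Y : Type*} [Fintype X] [Fintype Y]

theorem IsJoint.sum_margX {q : X → Y → ℝ} (hq : IsJoint q) : ∑ x, margX q x = 1 := hq.2

theorem IsJoint.sum_margY {q : X → Y → ℝ} (hq : IsJoint q) : ∑ y, margY q y = 1 := by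
  rw [← hq.2, Finset.sum_comm]; rfl

theorem mutInfo_nonneg {q : X → Y → ℝ} (hq : IsJoint q) : 0 ≤ mutInfo q := by
  have h : ∑ x, ∑ y, (q x y - margX q x * margY q y) ≤ mutInfo q := by
    refine Finset.sum_le_sum fun x _ => Finset.sum_le_sum fun y _ => ?_
    refine mul_log_div_ge_sub (hq.1 x y)
      (mul_nonneg (margX_nonneg hq.1 x) (margY_nonneg hq.1 y)) fun h => ?_
    rcases mul_eq_zero.1 h with h | h
    · exact eq_zero_of_margX hq.1 y h
    · exact eq_zero_of_margY hq.1 x h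
  simp only [Finset.sum_sub_distrib, ← Finset.mul_sum, ← Finset.sum_mul, hq.sum_margY,
    hq.sum_margX, hq.2] at h
  linarith

theorem klX_nonneg {q : X → Y → ℝ} (hq : IsJoint q) {P : X → ℝ} (hP : IsDist P)
    (hPpos : ∀ x, 0 < P x) : 0 ≤ klX q P := by
  have h : ∑ x, (margX q x - P x) ≤ klX q P := Finset.sum_le_sum fun x _ =>
    mul_log_div_ge_sub (margX_nonneg hq.1 x) (hP.1 x) fun h => absurd h (hPpos x).ne'
  rw [Finset.sum_sub_distrib, hq.sum_margX, hP.2] at h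
  linarith

/-- The sum of the positive parts of `P - q_X` is at most the square root of the divergence. -/
theorem sum_posPart_sub_le_sqrt_klX {q : X → Y → ℝ} (hq : IsJoint q) {P : X → ℝ}
    (hP : IsDist P) (hPpos : ∀ x, 0 < P x) :
    ∑ x, max 0 (P x - margX q x) ≤ √(klX q P) := by
  have hQ := margX_nonneg hq.1
  have hell : ∑ x, (√(P x) - √(margX q x)) ^ 2 ≤ klX q P := by
    have h : ∑ x, (2 * margX q x - 2 * (√(P x) * √(margX q x))) ≤ klX q P := by
      refine Finset.sum_le_sum fun x _ => ?_
      rcases (hQ x).eq_or_lt with h0 | h0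
      · simp [← h0]
      have hp := hPpos x
      have hc : 0 < √(margX q x) / √(P x) := by positivity
      have h := mul_log_div_ge_sub (hQ x) (b := √(P x) * √(margX q x)) (by positivity)
        (fun h => absurd h (by positivity))
      have e : log (margX q x / P x) = 2 * log (margX q x / (√(P x) * √(margX q x))) := by
        rw [log_div h0.ne' hp.ne', log_div h0.ne' (by positivity),
          log_mul (by positivity) (by positivity), log_sqrt hp.le, log_sqrt h0.le]
        ring
      rw [e]; linarith
    refine le_trans (le_of_eq ?_) h
    have e : ∀ x, (√(P x) - √(margX q x)) ^ 2 =
        (2 * margX q x - 2 * (√(P x) * √(margX q x))) + (P x - margX q x) := fun x => by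
      have h1 := sq_sqrt (hP.1 x)
      have h2 := sq_sqrt (hQ x)
      linear_combination h1 + h2
    simp_rw [e]
    rw [Finset.sum_add_distrib, Finset.sum_sub_distrib (f := P), hP.2, hq.sum_margX]
    ring
  have hplus : ∑ x, (√(P x) + √(margX q x)) ^ 2 ≤ 4 := by
    calc _ ≤ ∑ x, (2 * P x + 2 * margX q x) := by
          refine Finset.sum_le_sum fun x _ => ?_
          nlinarith [sq_sqrt (hP.1 x), sq_sqrt (hQ x), sq_nonneg (√(P x) - √(margX q x))]
      _ = 4 := by
          rw [Finset.sum_add_distrib, ← Finset.mul_sum, ← Finset.mul_sum, hP.2, hq.sum_margX]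
          norm_num
  have hl1 : ∑ x, |P x - margX q x| = 2 * ∑ x, max 0 (P x - margX q x) := by
    have e : ∀ x, |P x - margX q x| = 2 * max 0 (P x - margX q x) - (P x - margX q x) :=
      fun x => by
        rcases le_total 0 (P x - margX q x) with h | h
        · rw [abs_of_nonneg h, max_eq_right h]; ring
        · rw [abs_of_nonpos h, max_eq_left h]; ring
    simp_rw [e]
    rw [Finset.sum_sub_distrib, Finset.sum_sub_distrib (f := P), hP.2, hq.sum_margX,
      ← Finset.mul_sum]
    ring
  have hcs : (∑ x, |P x - margX q x|) ^ 2 ≤ klX q P * 4 := by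
    have e : ∀ x, |P x - margX q x| =
        |√(P x) - √(margX q x)| * (√(P x) + √(margX q x)) := fun x => by
      rw [← abs_of_nonneg (show 0 ≤ √(P x) + √(margX q x) by positivity), ← abs_mul]
      congr 1
      nlinarith [sq_sqrt (hP.1 x), sq_sqrt (hQ x)]
    simp_rw [e]
    refine (Finset.sum_mul_sq_le_sq_mul_sq _ _ _).trans ?_
    simp only [sq_abs]
    exact mul_le_mul hell hplus (Finset.sum_nonneg fun _ _ => sq_nonneg _)
      (klX_nonneg hq hP hPpos)
  rw [hl1] at hcs
  exact le_sqrt_of_sq_le (by linarith)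

theorem mutInfo_le_log_card_right {q : X → Y → ℝ} (hq : IsJoint q)
    (hY : 0 < Fintype.card Y) : mutInfo q ≤ log (Fintype.card Y) := by
  have hn : (0 : ℝ) < Fintype.card Y := by exact_mod_cast hY
  have h : mutInfo q ≤ ∑ x, ∑ y, (q x y * log (Fintype.card Y) +
      q x y * (1 / (margY q y * Fintype.card Y)) - q x y) := by
    refine Finset.sum_le_sum fun x _ => Finset.sum_le_sum fun y _ => ?_
    rcases (hq.1 x y).eq_or_lt with h0 | h0
    · simp [← h0]
    have hx : 0 < margX q x := h0.trans_le (le_margX hq.1 x y)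
    have hy : 0 < margY q y := h0.trans_le (le_margY hq.1 x y)
    have h1 : log (q x y / (margX q x * margY q y)) ≤ log (1 / margY q y) := by
      refine log_le_log (by positivity) ?_
      rw [div_le_div_iff₀ (by positivity) hy]
      nlinarith [mul_le_mul_of_nonneg_right (le_margX hq.1 x y) hy.le]
    have h2 := log_le_sub_one_of_pos (show 0 < 1 / (margY q y * Fintype.card Y) by positivity)
    have h3 : log (1 / (margY q y * Fintype.card Y)) =
        log (1 / margY q y) - log (Fintype.card Y) := by
      rw [one_div, one_div, log_inv, log_inv, log_mul hy.ne' hn.ne']; ring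
    nlinarith
  refine h.trans ?_
  simp only [Finset.sum_sub_distrib, Finset.sum_add_distrib, ← Finset.sum_mul, hq.2]
  rw [Finset.sum_comm]
  have h4 : ∑ y, ∑ x, q x y * (1 / (margY q y * Fintype.card Y)) ≤
      ∑ _y : Y, 1 / (Fintype.card Y : ℝ) := by
    refine Finset.sum_le_sum fun y _ => ?_
    rw [← Finset.sum_mul]
    change margY q y * _ ≤ _
    rcases (margY_nonneg hq.1 y).eq_or_lt with h0 | h0
    · rw [← h0, zero_mul]; positivity
    · apply le_of_eq; field_simp
  have h5 : ∑ _y : Y, 1 / (Fintype.card Y : ℝ) = 1 := by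
    simp [hn.ne']
  linarith

theorem mutInfo_swap (q : X → Y → ℝ) : mutInfo (fun y x => q x y) = mutInfo q := by
  unfold mutInfo
  rw [Finset.sum_comm]
  refine Finset.sum_congr rfl fun x _ => Finset.sum_congr rfl fun y _ => ?_
  rw [mul_comm (margX q x)]; rfl

theorem mutInfo_le_log_card_left {q : X → Y → ℝ} (hq : IsJoint q)
    (hX : 0 < Fintype.card X) : mutInfo q ≤ log (Fintype.card X) := by
  rw [← mutInfo_swap]
  exact mutInfo_le_log_card_right ⟨fun y x => hq.1 x y, by rw [Finset.sum_comm]; exact hq.2⟩ hX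

theorem margX_mul_cond {P : X → ℝ} {V : X → Y → ℝ} (hV : IsCond V) (x : X) :
    margX (fun x y => P x * V x y) x = P x := by
  simp [margX, ← Finset.mul_sum, hV.2 x]

theorem isJoint_mul_cond {P : X → ℝ} (hP : IsDist P) {V : X → Y → ℝ} (hV : IsCond V) :
    IsJoint fun x y => P x * V x y :=
  ⟨fun x y => mul_nonneg (hP.1 x) (hV.1 x y), by simp [← Finset.mul_sum, hV.2, hP.2]⟩

theorem klX_mul_cond (P : X → ℝ) {V : X → Y → ℝ} (hV : IsCond V) :
    klX (fun x y => P x * V x y) P = 0 := by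
  refine Finset.sum_eq_zero fun x _ => ?_
  rw [margX_mul_cond hV]
  by_cases h : P x = 0 <;> simp [h]

theorem exists_isCond_Ed_eq_zero (P : X → ℝ) {d : X → Y → ℝ} (hd0 : ∀ x, ∃ y, d x y = 0) :
    ∃ V : X → Y → ℝ, IsCond V ∧ Ed (fun x y => P x * V x y) d = 0 := by
  classical
  choose f hf using hd0
  refine ⟨fun x y => if y = f x then 1 else 0, ⟨fun x y => ?_, fun x => ?_⟩, ?_⟩
  · dsimp only; split_ifs <;> norm_num
  · simp
  · simp [Ed, hf]

theorem RD_le {P : X → ℝ} (hP : IsDist P) {d : X → Y → ℝ} {Δ : ℝ} {V : X → Y → ℝ}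
    (hV : IsCond V) (hVd : Ed (fun x y => P x * V x y) d ≤ Δ) :
    RD P d Δ ≤ mutInfo fun x y => P x * V x y := by
  refine csInf_le ⟨0, ?_⟩ ⟨V, hV, hVd, rfl⟩
  rintro _ ⟨W, hW, -, rfl⟩
  exact mutInfo_nonneg (isJoint_mul_cond hP hW)

theorem RD_set_nonempty (P : X → ℝ) {d : X → Y → ℝ} (hd0 : ∀ x, ∃ y, d x y = 0) {Δ : ℝ}
    (hΔ : 0 ≤ Δ) : {v : ℝ | ∃ V : X → Y → ℝ, IsCond V ∧
      Ed (fun x y => P x * V x y) d ≤ Δ ∧ v = mutInfo (fun x y => P x * V x y)}.Nonempty := by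
  obtain ⟨V, hV, h⟩ := exists_isCond_Ed_eq_zero P hd0
  exact ⟨_, V, hV, h.trans_le hΔ, rfl⟩

theorem Rcut_set_nonempty {P : X → ℝ} (hP : IsDist P) {d : X → Y → ℝ}
    (hd0 : ∀ x, ∃ y, d x y = 0) (lam : ℝ) {Δ : ℝ} (hΔ : 0 ≤ Δ) :
    {v : ℝ | ∃ q : X → Y → ℝ, IsJoint q ∧ Ed q d ≤ Δ ∧
      v = mutInfo q + (1 / lam) * klX q P}.Nonempty := by
  obtain ⟨V, hV, h⟩ := exists_isCond_Ed_eq_zero P hd0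
  exact ⟨_, _, isJoint_mul_cond hP hV, h.trans_le hΔ, rfl⟩

theorem Rcut_le {P : X → ℝ} (hP : IsDist P) (hPpos : ∀ x, 0 < P x) {d : X → Y → ℝ}
    {lam Δ : ℝ} (hlam : 0 < lam) {q : X → Y → ℝ} (hq : IsJoint q) (hqd : Ed q d ≤ Δ) :
    Rcut P d lam Δ ≤ mutInfo q + (1 / lam) * klX q P := by
  refine csInf_le ⟨0, ?_⟩ ⟨q, hq, hqd, rfl⟩
  rintro _ ⟨W, hW, -, rfl⟩
  have := mutInfo_nonneg hW
  have := klX_nonneg hW hP hPpos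
  positivity

theorem Rcut_anti {P : X → ℝ} (hP : IsDist P) (hPpos : ∀ x, 0 < P x) {d : X → Y → ℝ}
    (hd0 : ∀ x, ∃ y, d x y = 0) {Δ : ℝ} (hΔ : 0 ≤ Δ) {lam₁ lam₂ : ℝ} (h₁ : 0 < lam₁)
    (h₁₂ : lam₁ ≤ lam₂) : Rcut P d lam₂ Δ ≤ Rcut P d lam₁ Δ := by
  refine le_csInf (Rcut_set_nonempty hP hd0 _ hΔ) ?_
  rintro _ ⟨q, hq, hqd, rfl⟩
  refine (Rcut_le hP hPpos (h₁.trans_le h₁₂) hq hqd).trans ?_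
  have := klX_nonneg hq hP hPpos
  gcongr

theorem Rcut_le_RD {P : X → ℝ} (hP : IsDist P) (hPpos : ∀ x, 0 < P x) {d : X → Y → ℝ}
    (hd0 : ∀ x, ∃ y, d x y = 0) {Δ : ℝ} (hΔ : 0 ≤ Δ) {lam : ℝ} (hlam : 0 < lam) :
    Rcut P d lam Δ ≤ RD P d Δ := by
  refine le_csInf (RD_set_nonempty P hd0 hΔ) ?_
  rintro _ ⟨V, hV, hVd, rfl⟩
  have h := Rcut_le hP hPpos hlam (isJoint_mul_cond hP hV) hVd
  rwa [klX_mul_cond P hV, mul_zero, add_zero] at h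

theorem RD_le_min_log_card {P : X → ℝ} (hP : IsDist P) {d : X → Y → ℝ}
    (hd0 : ∀ x, ∃ y, d x y = 0) {Δ : ℝ} (hΔ : 0 ≤ Δ) (hX : 0 < Fintype.card X)
    (hY : 0 < Fintype.card Y) :
    RD P d Δ ≤ min (log (Fintype.card X)) (log (Fintype.card Y)) := by
  obtain ⟨V, hV, h⟩ := exists_isCond_Ed_eq_zero P hd0
  have hJ := isJoint_mul_cond hP hV
  exact (RD_le hP hV (h.trans_le hΔ)).trans
    (le_min (mutInfo_le_log_card_left hJ hX) (mutInfo_le_log_card_right hJ hY))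

/-- For a fixed input distribution, mutual information is convex in the channel. -/
theorem mutInfo_convex {P : X → ℝ} (hP : IsDist P) {V W : X → Y → ℝ} (hV : IsCond V)
    (hW : IsCond W) {s t : ℝ} (hs : 0 ≤ s) (ht : 0 ≤ t)
    (hU : IsCond fun x y => s * V x y + t * W x y) :
    mutInfo (fun x y => P x * (s * V x y + t * W x y)) ≤
      s * mutInfo (fun x y => P x * V x y) + t * mutInfo (fun x y => P x * W x y) := by
  have hJV := isJoint_mul_cond hP hV
  have hJW := isJoint_mul_cond hP hW
  simp only [mutInfo, Finset.mul_sum, ← Finset.sum_add_distrib]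
  refine Finset.sum_le_sum fun x _ => Finset.sum_le_sum fun y _ => ?_
  rw [margX_mul_cond hU, margX_mul_cond hV, margX_mul_cond hW]
  have key : ∀ {A : X → Y → ℝ}, IsJoint (fun x y => P x * A x y) →
      P x * margY (fun x y => P x * A x y) y = 0 → P x * A x y = 0 := by
    intro A hA h
    rcases mul_eq_zero.1 h with h | h
    · rw [h, zero_mul]
    · exact eq_zero_of_margY hA.1 x h
  have h := mul_log_div_convex (hJV.1 x y) (mul_nonneg (hP.1 x) (margY_nonneg hJV.1 y))
    (key hJV) (hJW.1 x y) (mul_nonneg (hP.1 x) (margY_nonneg hJW.1 y)) (key hJW) hs ht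
  have e1 : P x * (s * V x y + t * W x y) = s * (P x * V x y) + t * (P x * W x y) := by ring
  have e2 : P x * margY (fun x y => P x * (s * V x y + t * W x y)) y =
      s * (P x * margY (fun x y => P x * V x y) y) +
        t * (P x * margY (fun x y => P x * W x y) y) := by
    simp only [margY, Finset.mul_sum, ← Finset.sum_add_distrib]
    refine Finset.sum_congr rfl fun z _ => ?_
    ring
  rw [e2, e1]
  exact h

theorem convexOn_RD {P : X → ℝ} (hP : IsDist P) {d : X → Y → ℝ}
    (hd0 : ∀ x, ∃ y, d x y = 0) : ConvexOn ℝ (Set.Ici 0) (RD P d) := by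
  refine ⟨convex_Ici 0, fun Δ₁ h₁ Δ₂ h₂ s t hs ht hst => ?_⟩
  simp only [smul_eq_mul]
  refine le_of_forall_pos_le_add fun ε hε => ?_
  obtain ⟨_, ⟨V, hV, hVd, rfl⟩, hVε⟩ :=
    exists_lt_of_csInf_lt (RD_set_nonempty P hd0 h₁) (lt_add_of_pos_right (RD P d Δ₁) hε)
  obtain ⟨_, ⟨W, hW, hWd, rfl⟩, hWε⟩ :=
    exists_lt_of_csInf_lt (RD_set_nonempty P hd0 h₂) (lt_add_of_pos_right (RD P d Δ₂) hε)
  have hU : IsCond fun x y => s * V x y + t * W x y :=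
    ⟨fun x y => add_nonneg (mul_nonneg hs (hV.1 x y)) (mul_nonneg ht (hW.1 x y)),
      fun x => by simp [Finset.sum_add_distrib, ← Finset.mul_sum, hV.2 x, hW.2 x, hst]⟩
  have hUd : Ed (fun x y => P x * (s * V x y + t * W x y)) d ≤ s * Δ₁ + t * Δ₂ := by
    have e : Ed (fun x y => P x * (s * V x y + t * W x y)) d =
        s * Ed (fun x y => P x * V x y) d + t * Ed (fun x y => P x * W x y) d := by
      simp only [Ed, Finset.mul_sum, ← Finset.sum_add_distrib]
      refine Finset.sum_congr rfl fun x _ => Finset.sum_congr rfl fun y _ => ?_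
      ring
    rw [e]
    gcongr
  have h1 := RD_le hP hU hUd
  have h2 := mutInfo_convex hP hV hW hs ht hU
  have h3 := mul_le_mul_of_nonneg_left hVε.le hs
  have h4 := mul_le_mul_of_nonneg_left hWε.le ht
  have h5 : s * ε + t * ε = ε := by rw [← add_mul, hst, one_mul]
  linarith

theorem RD_add_ge {P : X → ℝ} (hP : IsDist P) {d : X → Y → ℝ}
    (hd0 : ∀ x, ∃ y, d x y = 0) {Δ : ℝ} (hΔ : 0 ≤ Δ) {R' : ℝ}
    (hderiv : HasDerivAt (fun Δ' : ℝ => RD P d Δ') R' Δ) {s : ℝ} (hs : 0 ≤ s) :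
    RD P d Δ + R' * s ≤ RD P d (Δ + s) := by
  rcases hs.eq_or_lt with rfl | hs
  · simp
  have h := (convexOn_RD hP hd0).le_slope_of_hasDerivAt (Set.mem_Ici.2 hΔ)
    (Set.mem_Ici.2 (by linarith : 0 ≤ Δ + s)) (by linarith) hderiv
  rw [slope_def_field, le_div_iff₀ (by linarith)] at h
  linarith [show R' * (Δ + s - Δ) = R' * s by ring]

/-- Replacing the output marginal by any positive distribution increases mutual information. -/
theorem mutInfo_mul_cond_le {P : X → ℝ} (hP : IsDist P) (hPpos : ∀ x, 0 < P x)
    {V : X → Y → ℝ} (hV : IsCond V) {R : Y → ℝ} (hR : ∀ y, 0 < R y) (hR1 : ∑ y, R y = 1) :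
    mutInfo (fun x y => P x * V x y) ≤ ∑ x, P x * ∑ y, V x y * log (V x y / R y) := by
  have hJ := isJoint_mul_cond hP hV
  set M := margY (fun x y => P x * V x y) with hM
  have hM0 : ∀ y, 0 ≤ M y := margY_nonneg hJ.1
  have h : ∀ x y, P x * V x y * log (P x * V x y / (P x * M y)) ≤
      P x * (V x y * log (V x y / R y)) - P x * V x y * log (M y / R y) := by
    intro x y
    rcases (hV.1 x y).eq_or_lt with h0 | h0
    · simp [← h0]
    have hp := hPpos x
    have hMy : 0 < M y := lt_of_lt_of_le (mul_pos hp h0) (le_margY hJ.1 x y)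
    rw [mul_div_mul_left _ _ hp.ne', log_div h0.ne' hMy.ne', log_div h0.ne' (hR y).ne',
      log_div hMy.ne' (hR y).ne']
    apply le_of_eq; ring
  have hsum : mutInfo (fun x y => P x * V x y) ≤ ∑ x, ∑ y,
      (P x * (V x y * log (V x y / R y)) - P x * V x y * log (M y / R y)) := by
    refine Finset.sum_le_sum fun x _ => Finset.sum_le_sum fun y _ => ?_
    rw [margX_mul_cond hV]
    exact h x y
  simp only [Finset.sum_sub_distrib, ← Finset.mul_sum] at hsum
  have hkl : 0 ≤ ∑ x, ∑ y, P x * V x y * log (M y / R y) := by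
    rw [Finset.sum_comm]
    simp_rw [← Finset.sum_mul]
    have h1 : ∑ y, (M y - R y) ≤ ∑ y, M y * log (M y / R y) := Finset.sum_le_sum fun y _ =>
      mul_log_div_ge_sub (hM0 y) (hR y).le fun h => absurd h (hR y).ne'
    rw [Finset.sum_sub_distrib, hJ.sum_margY, hR1, sub_self] at h1
    exact h1
  linarith

/-- Every joint distribution factors through its `X`-marginal. -/
theorem IsJoint.exists_isCond {q : X → Y → ℝ} (hq : IsJoint q) (hY : 0 < Fintype.card Y) :
    ∃ V : X → Y → ℝ, IsCond V ∧ ∀ x y, q x y = margX q x * V x y := by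
  classical
  have hn : (0 : ℝ) < Fintype.card Y := by exact_mod_cast hY
  refine ⟨fun x y => if margX q x = 0 then 1 / Fintype.card Y else q x y / margX q x,
    ⟨fun x y => ?_, fun x => ?_⟩, fun x y => ?_⟩
  · dsimp only
    split_ifs
    · positivity
    · exact div_nonneg (hq.1 x y) (margX_nonneg hq.1 x)
  · by_cases h : margX q x = 0
    · simp [h, hn.ne']
    · simp only [h, if_false, ← Finset.sum_div]
      exact div_self h
  · by_cases h : margX q x = 0
    · simp [h, eq_zero_of_margX hq.1 y h]
    · simp only [h, if_false]
      field_simp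

theorem sum_mul_le_add {a b g : X → ℝ} {L δ : ℝ} (hg : ∀ x, 0 ≤ g x) (hgL : ∀ x, g x ≤ L)
    (hL : 0 ≤ L) (hδ : ∑ x, max 0 (a x - b x) ≤ δ) :
    ∑ x, a x * g x ≤ ∑ x, b x * g x + δ * L := by
  have h : ∑ x, a x * g x ≤ ∑ x, (b x * g x + max 0 (a x - b x) * L) := by
    refine Finset.sum_le_sum fun x _ => ?_
    have h1 : (a x - b x) * g x ≤ max 0 (a x - b x) * L :=
      mul_le_mul (le_max_right _ _) (hgL x) (hg x) (le_max_left _ _)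
    linarith
  rw [Finset.sum_add_distrib, ← Finset.sum_mul] at h
  linarith [mul_le_mul_of_nonneg_right hδ hL]

/-- The rate distortion function of `P` is bounded by the mutual information of a joint
distribution with a nearby `X`-marginal. -/
theorem RD_le_mutInfo_add {P : X → ℝ} (hP : IsDist P) (hPpos : ∀ x, 0 < P x)
    {d : X → Y → ℝ} (hd : ∀ x y, 0 ≤ d x y) {dmax : ℝ} (hdmax : ∀ x y, d x y ≤ dmax)
    (hdmax0 : 0 ≤ dmax) (hY : 0 < Fintype.card Y) {Δ : ℝ} {q : X → Y → ℝ} (hq : IsJoint q)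
    (hqd : Ed q d ≤ Δ) {δ : ℝ} (hδ0 : 0 < δ) (hδ1 : δ < 1)
    (hδ : ∑ x, max 0 (P x - margX q x) ≤ δ) :
    RD P d (Δ + dmax * δ) ≤
      mutInfo q - log (1 - δ) + δ * (log (Fintype.card Y) - log δ) := by
  have hn : (0 : ℝ) < Fintype.card Y := by exact_mod_cast hY
  have hn1 : (1 : ℝ) ≤ Fintype.card Y := by exact_mod_cast hY
  have hδ1' : 0 < 1 - δ := by linarith
  obtain ⟨V, hV, hqV⟩ := hq.exists_isCond hY
  have hV1 : ∀ x y, V x y ≤ 1 := fun x y => hV.2 x ▸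
    Finset.single_le_sum (f := fun y => V x y) (fun y _ => hV.1 x y) (Finset.mem_univ y)
  have hVd : Ed (fun x y => P x * V x y) d ≤ Δ + dmax * δ := by
    have h := sum_mul_le_add (g := fun x => ∑ y, V x y * d x y) (L := dmax)
      (fun x => Finset.sum_nonneg fun y _ => mul_nonneg (hV.1 x y) (hd x y))
      (fun x => by
        calc _ ≤ ∑ y, V x y * dmax := Finset.sum_le_sum fun y _ =>
              mul_le_mul_of_nonneg_left (hdmax x y) (hV.1 x y)
          _ = dmax := by rw [← Finset.sum_mul, hV.2 x, one_mul]) hdmax0 hδ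
    have e : ∑ x, margX q x * ∑ y, V x y * d x y = Ed q d := by
      simp only [Ed, Finset.mul_sum]
      refine Finset.sum_congr rfl fun x _ => Finset.sum_congr rfl fun y _ => ?_
      rw [hqV x y]; ring
    have e' : Ed (fun x y => P x * V x y) d = ∑ x, P x * ∑ y, V x y * d x y := by
      simp only [Ed, Finset.mul_sum, mul_assoc]
    rw [e']
    linarith
  refine (RD_le hP hV hVd).trans ?_
  set R : Y → ℝ := fun y => (1 - δ) * margY q y + δ / Fintype.card Y with hRdef
  have hMY := margY_nonneg hq.1
  have hRlow : ∀ y, δ / Fintype.card Y ≤ R y := fun y => by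
    have := mul_nonneg hδ1'.le (hMY y)
    simp only [hRdef]; linarith
  have hR : ∀ y, 0 < R y := fun y => lt_of_lt_of_le (by positivity) (hRlow y)
  have hR1 : ∑ y, R y = 1 := by
    simp only [hRdef, Finset.sum_add_distrib, ← Finset.mul_sum, hq.sum_margY]
    simp only [Finset.sum_const, Finset.card_univ, nsmul_eq_mul]
    field_simp
    ring
  refine (mutInfo_mul_cond_le hP hPpos hV hR hR1).trans ?_
  have hL : 0 ≤ log (Fintype.card Y) - log δ := by
    have := log_nonneg hn1
    have := log_nonpos hδ0.le hδ1.le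
    linarith
  have h := sum_mul_le_add (g := fun x => ∑ y, V x y * log (V x y / R y))
    (L := log (Fintype.card Y) - log δ) (fun x => ?_) (fun x => ?_) hL hδ
  · refine h.trans (add_le_add_left ?_ _)
    have h2 : ∑ x, margX q x * ∑ y, V x y * log (V x y / R y) ≤
        ∑ x, ∑ y, (q x y * log (q x y / (margX q x * margY q y)) - q x y * log (1 - δ)) := by
      simp only [Finset.mul_sum]
      refine Finset.sum_le_sum fun x _ => Finset.sum_le_sum fun y _ => ?_
      rw [← mul_assoc, ← hqV x y, ← mul_sub]
      rcases (hq.1 x y).eq_or_lt with h0 | h0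
      · simp [← h0]
      refine mul_le_mul_of_nonneg_left ?_ h0.le
      have hx : 0 < margX q x := h0.trans_le (le_margX hq.1 x y)
      have hy : 0 < margY q y := h0.trans_le (le_margY hq.1 x y)
      have hv : 0 < V x y := by
        rw [hqV x y] at h0
        exact pos_of_mul_pos_right h0 hx.le
      have hle : log ((1 - δ) * margY q y) ≤ log (R y) := by
        refine log_le_log (by positivity) ?_
        simp only [hRdef]
        have : 0 < δ / Fintype.card Y := by positivity
        linarith
      rw [log_mul hδ1'.ne' hy.ne'] at hle
      rw [hqV x y, mul_div_mul_left _ _ hx.ne', log_div hv.ne' hy.ne',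
        log_div hv.ne' (hR y).ne']
      linarith
    refine h2.trans (le_of_eq ?_)
    simp only [Finset.sum_sub_distrib, ← Finset.sum_mul, hq.2, one_mul]
    rfl
  · have h1 : ∑ y, (V x y - R y) ≤ ∑ y, V x y * log (V x y / R y) :=
      Finset.sum_le_sum fun y _ =>
        mul_log_div_ge_sub (hV.1 x y) (hR y).le fun h => absurd h (hR y).ne'
    rw [Finset.sum_sub_distrib, hV.2 x, hR1, sub_self] at h1
    exact h1
  · calc _ ≤ ∑ y, V x y * (log (Fintype.card Y) - log δ) := by
          refine Finset.sum_le_sum fun y _ => ?_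
          rcases (hV.1 x y).eq_or_lt with h0 | h0
          · simp [← h0]
          refine mul_le_mul_of_nonneg_left ?_ h0.le
          have h1 := log_le_log (by positivity) (hRlow y)
          have h2 := log_nonpos h0.le (hV1 x y)
          rw [log_div hδ0.ne' hn.ne'] at h1
          rw [log_div h0.ne' (hR y).ne']
          linarith
      _ = _ := by rw [← Finset.sum_mul, hV.2 x, one_mul]

/-- Quantitative lower bound for the cutoff rate, with `δ = √(2αλ)`. -/
theorem RD_sub_Rcut_le (hX : 2 ≤ Fintype.card X) (hY : 2 ≤ Fintype.card Y)
    {P : X → ℝ} (hP : IsDist P) (hPpos : ∀ x, 0 < P x)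
    {d : X → Y → ℝ} (hd : ∀ x y, 0 ≤ d x y) (hd0 : ∀ x, ∃ y, d x y = 0)
    {Δ : ℝ} (hΔ : 0 ≤ Δ) {dmax : ℝ} (hdmax : ∀ x y, d x y ≤ dmax) (hdmax0 : 0 ≤ dmax)
    {R' : ℝ} (hderiv : HasDerivAt (fun Δ' : ℝ => RD P d Δ') R' Δ) {lam δ : ℝ}
    (hlam : 0 < lam) (hδ0 : 0 < δ) (hδ1 : δ ≤ 1 / 2)
    (hδlam : δ ^ 2 = 2 * min (log (Fintype.card X)) (log (Fintype.card Y)) * lam) :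
    RD P d Δ - Rcut P d lam Δ ≤
      δ * (-3 * log δ + 2 * (log (Fintype.card X) + log (Fintype.card Y)) + dmax * |R'|) := by
  have hl2 := log_two_gt_d9
  have hlX : log 2 ≤ log (Fintype.card X) := log_le_log two_pos (by exact_mod_cast hX)
  have hlY : log 2 ≤ log (Fintype.card Y) := log_le_log two_pos (by exact_mod_cast hY)
  have hlδ : log δ ≤ - log 2 := by
    rw [← log_inv]
    exact log_le_log hδ0 (by linarith)
  have hR'abs : 0 ≤ dmax * |R'| := by positivity
  rw [sub_le_comm]
  refine le_csInf (Rcut_set_nonempty hP hd0 _ hΔ) ?_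
  rintro _ ⟨q, hq, hqd, rfl⟩
  have hI := mutInfo_nonneg hq
  have hD := klX_nonneg hq hP hPpos
  rcases le_total (RD P d Δ) (mutInfo q + 1 / lam * klX q P) with hle | hle
  · have : 0 ≤ δ * (-3 * log δ + 2 * (log (Fintype.card X) + log (Fintype.card Y)) +
        dmax * |R'|) := mul_nonneg hδ0.le (by linarith)
    linarith
  have hα := RD_le_min_log_card hP hd0 hΔ (by omega : 0 < Fintype.card X)
    (by omega : 0 < Fintype.card Y)
  have hDδ : klX q P ≤ δ ^ 2 := by
    have h1 : 1 / lam * klX q P ≤ min (log (Fintype.card X)) (log (Fintype.card Y)) := by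
      linarith
    rw [one_div_mul_eq_div, div_le_iff₀ hlam] at h1
    have : 0 ≤ δ ^ 2 := sq_nonneg δ
    linarith
  have htv : ∑ x, max 0 (P x - margX q x) ≤ δ :=
    (sum_posPart_sub_le_sqrt_klX hq hP hPpos).trans (sqrt_le_iff.2 ⟨hδ0.le, hDδ⟩)
  have h1 := RD_le_mutInfo_add hP hPpos hd hdmax hdmax0 (by omega) hq hqd hδ0
    (by linarith) htv
  have h2 := RD_add_ge hP hd0 hΔ hderiv (show 0 ≤ dmax * δ by positivity)
  have h3 : -log (1 - δ) ≤ 2 * δ := by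
    have h := log_le_sub_one_of_pos (show 0 < (1 - δ)⁻¹ from inv_pos.2 (by linarith))
    rw [log_inv] at h
    have h' : (1 - δ)⁻¹ ≤ 1 + 2 * δ := by
      rw [inv_le_iff_one_le_mul₀ (by linarith)]
      nlinarith
    linarith
  have h4 : -(R' * (dmax * δ)) ≤ |R'| * (dmax * δ) := by
    rw [← neg_mul]
    exact mul_le_mul_of_nonneg_right (neg_le_abs R') (by positivity)
  have h5 : 0 ≤ 1 / lam * klX q P := by positivity
  have h6 : 0 ≤ δ * (-2 * log δ + 2 * log (Fintype.card X) + log (Fintype.card Y) - 2) :=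
    mul_nonneg hδ0.le (by linarith)
  linarith

end

/-- Proposition 2: monotonicity of `λ ↦ R_cut^{(λ)}(Δ|P)`, the
quantitative bound `0 ≤ R(Δ|P) − R_cut^{(λ)}(Δ|P) ≤ c₁√λ (log(1/λ) + c₂)` for
`0 < λ ≤ 1/(8α)`, and the consequence `R_cut^{(λ)}(Δ|P) → R(Δ|P)` as `λ → 0⁺`. -/
theorem stmt18 {X Y : Type*} [Fintype X] [Fintype Y]
    (hX : 2 ≤ Fintype.card X) (hY : 2 ≤ Fintype.card Y)
    (P : X → ℝ) (hP : IsDist P) (hPpos : ∀ x, 0 < P x)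
    (d : X → Y → ℝ) (hd : ∀ x y, 0 ≤ d x y) (hd0 : ∀ x, ∃ y, d x y = 0)
    (Δ : ℝ) (hΔ : 0 ≤ Δ)
    (dmax : ℝ) (hdmaxub : ∀ x y, d x y ≤ dmax) (hdmaxmem : ∃ x y, d x y = dmax)
    (R' : ℝ) (hderiv : HasDerivAt (fun Δ' : ℝ => RD P d Δ') R' Δ)
    (α c₁ c₂ : ℝ)
    (hα : α = min (Real.log (Fintype.card X)) (Real.log (Fintype.card Y)))
    (hc₁ : c₁ = (3 / 2) * Real.sqrt (2 * α))
    (hc₂ : c₂ = (4 / 3) * Real.log ((Fintype.card X : ℝ) * (Fintype.card Y : ℝ))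
      - Real.log (2 * α) + (2 / 3) * dmax * |R'|) :
    (∀ lam₁ lam₂ : ℝ, 0 < lam₁ → lam₁ ≤ lam₂ → lam₂ ≤ 1 →
      Rcut P d lam₂ Δ ≤ Rcut P d lam₁ Δ) ∧
    (∀ lam : ℝ, 0 < lam → lam ≤ 1 / (8 * α) →
      0 ≤ RD P d Δ - Rcut P d lam Δ ∧
      RD P d Δ - Rcut P d lam Δ ≤
        c₁ * Real.sqrt lam * (Real.log (1 / lam) + c₂)) ∧
    Filter.Tendsto (fun lam : ℝ => Rcut P d lam Δ)
      (nhdsWithin 0 (Set.Ioi 0)) (nhds (RD P d Δ)) := by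
  have hlX : log 2 ≤ log (Fintype.card X) := log_le_log two_pos (by exact_mod_cast hX)
  have hlY : log 2 ≤ log (Fintype.card Y) := log_le_log two_pos (by exact_mod_cast hY)
  have hα0 : 0 < α := by
    rw [hα]
    exact (log_pos one_lt_two).trans_le (le_min hlX hlY)
  have hdmax0 : 0 ≤ dmax := by
    obtain ⟨x, y, h⟩ := hdmaxmem
    exact h ▸ hd x y
  have hX0 : (Fintype.card X : ℝ) ≠ 0 := by positivity
  have hY0 : (Fintype.card Y : ℝ) ≠ 0 := by positivity
  have hbound : ∀ lam : ℝ, 0 < lam → lam ≤ 1 / (8 * α) →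
      0 ≤ RD P d Δ - Rcut P d lam Δ ∧
      RD P d Δ - Rcut P d lam Δ ≤
        c₁ * Real.sqrt lam * (Real.log (1 / lam) + c₂) := by
    intro lam hlam hlam8
    refine ⟨sub_nonneg.2 (Rcut_le_RD hP hPpos hd0 hΔ hlam), ?_⟩
    have hpos : 0 < 2 * α * lam := by positivity
    have hδ1 : √(2 * α * lam) ≤ 1 / 2 := by
      rw [sqrt_le_left (by norm_num)]
      rw [le_div_iff₀ (by positivity)] at hlam8
      linarith
    refine (RD_sub_Rcut_le hX hY hP hPpos hd hd0 hΔ hdmaxub hdmax0 hderiv hlam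
      (sqrt_pos.2 hpos) hδ1 (by rw [sq_sqrt hpos.le, hα])).trans (le_of_eq ?_)
    rw [hc₁, hc₂, log_sqrt hpos.le, sqrt_mul (by positivity), log_mul (by positivity) hlam.ne',
      log_mul hX0 hY0, one_div, log_inv]
    ring
  refine ⟨fun lam₁ lam₂ h₁ h₁₂ _ => Rcut_anti hP hPpos hd0 hΔ h₁ h₁₂, hbound, ?_⟩
  have hlim : Tendsto (fun lam : ℝ => RD P d Δ - c₁ * √lam * (log (1 / lam) + c₂))
      (nhdsWithin 0 (Set.Ioi 0)) (nhds (RD P d Δ)) := by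
    have h1 := tendsto_log_mul_rpow_nhdsGT_zero (r := 1 / 2) (by norm_num)
    have h2 : Tendsto (fun lam : ℝ => √lam) (nhdsWithin 0 (Set.Ioi 0)) (nhds 0) := by
      simpa using (continuous_sqrt.tendsto (0 : ℝ)).mono_left nhdsWithin_le_nhds
    have h3 := (((h1.const_mul (-c₁)).add (h2.const_mul (c₁ * c₂))).const_sub (RD P d Δ))
    simp only [mul_zero, add_zero, sub_zero] at h3
    refine h3.congr fun lam => ?_
    rw [← sqrt_eq_rpow, one_div, log_inv]
    ring
  have hsmall : ∀ᶠ lam : ℝ in nhdsWithin 0 (Set.Ioi 0), 0 < lam ∧ lam ≤ 1 / (8 * α) :=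
    Ioc_mem_nhdsGT (by positivity)
  refine tendsto_of_tendsto_of_tendsto_of_le_of_le' hlim tendsto_const_nhds ?_ ?_
  · filter_upwards [hsmall] with lam h
    linarith [(hbound lam h.1 h.2).2]
  · filter_upwards [hsmall] with lam h
    linarith [(hbound lam h.1 h.2).1]
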